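/- arXiv:1512.05423 — 2 statements merged into one kernel-verified Lean document; each statement's English description precedes it below -/
import Mathlib

section
/- Let {X_k}_{k≥1} be a stationary real-valued process such that for every n the vector X^n = (X_1,…,X_n) has a probability density f^(n) on ℝ^n with finite second moments, and suppose every f^(n) is (c1,c2)-regular with constants c1 > 0, c2 ≥ 0 independent of n. Then for every n ≥ 1, (1/n)·D(f^(n)) ≤ 2·c1·E[X_1²] + 2·c2·√(E[X_1²]) / √n. -/
open MeasureTheory Real ProbabilityTheory
open scoped BigOperators ENNReal

noncomputable section

/-- A probability density on `ℝⁿ` (Euclidean space): nonnegative, integrable, integrating to one. -/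
def IsDensity {n : ℕ} (f : EuclideanSpace ℝ (Fin n) → ℝ) : Prop :=
  (∀ x, 0 ≤ f x) ∧ Integrable f ∧ (∫ x, f x) = 1

/-- `(c₁, c₂)`-regularity of a density (Polyanskiy–Wu): everywhere positive, differentiable,
and `‖∇ log f(x)‖ ≤ c₁‖x‖ + c₂`. -/
def IsRegularDensity {n : ℕ} (c₁ c₂ : ℝ) (f : EuclideanSpace ℝ (Fin n) → ℝ) : Prop :=
  (∀ x, 0 < f x) ∧ Differentiable ℝ f ∧
    ∀ x : EuclideanSpace ℝ (Fin n),
      ‖gradient (fun y => Real.log (f y)) x‖ ≤ c₁ * ‖x‖ + c₂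

/-- Kullback–Leibler divergence between two densities (natural logarithm). -/
def klDiv' {n : ℕ} (f g : EuclideanSpace ℝ (Fin n) → ℝ) : ℝ :=
  ∫ x, f x * Real.log (f x / g x)

/-- Mean vector of a density. -/
def meanVec {n : ℕ} (f : EuclideanSpace ℝ (Fin n) → ℝ) : Fin n → ℝ :=
  fun i => ∫ x, f x * x i

/-- Covariance matrix of a density. -/
def covMat {n : ℕ} (f : EuclideanSpace ℝ (Fin n) → ℝ) : Matrix (Fin n) (Fin n) ℝ :=
  Matrix.of fun i j => ∫ x, f x * (x i - meanVec f i) * (x j - meanVec f j)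

/-- The Gaussian density on `ℝⁿ` with mean vector `m` and covariance matrix `R`. -/
def gaussDensity {n : ℕ} (m : Fin n → ℝ) (R : Matrix (Fin n) (Fin n) ℝ)
    (x : EuclideanSpace ℝ (Fin n)) : ℝ :=
  (2 * π) ^ (-(n : ℝ) / 2) * R.det ^ (-(1 : ℝ) / 2) *
    Real.exp (-(1 / 2) * ∑ i, ∑ j, (x i - m i) * R⁻¹ i j * (x j - m j))

/-- `D(f) = D(f ‖ g)` where `g` is the Gaussian density with the same mean vector and
covariance matrix as `f`. -/
def KLtoGauss {n : ℕ} (f : EuclideanSpace ℝ (Fin n) → ℝ) : ℝ :=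
  klDiv' f (gaussDensity (meanVec f) (covMat f))

/-- The vector `(X_k, X_{k+1}, …, X_{k+n-1})` of a process, as a point of Euclidean space. -/
def pathVec {Ω : Type*} (X : ℕ → Ω → ℝ) (k n : ℕ) (ω : Ω) : EuclideanSpace ℝ (Fin n) :=
  (WithLp.equiv 2 (Fin n → ℝ)).symm fun i : Fin n => X (k + i) ω

/-- The centered isotropic Gaussian density on `ℝⁿ` with covariance `v • Iₙ`. -/
def isoGaussDensity (n : ℕ) (v : ℝ) (x : EuclideanSpace ℝ (Fin n)) : ℝ :=
  (2 * π * v) ^ (-(n : ℝ) / 2) * Real.exp (-‖x‖ ^ 2 / (2 * v))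

/-- Log-concavity of a nonnegative function. -/
def LogConcaveFn {n : ℕ} (f : EuclideanSpace ℝ (Fin n) → ℝ) : Prop :=
  ∀ x y : EuclideanSpace ℝ (Fin n), ∀ t : ℝ, 0 ≤ t → t ≤ 1 →
    f x ^ t * f y ^ (1 - t) ≤ f (t • x + (1 - t) • y)

/-- A zero-mean Gaussian random vector with covariance matrix `R`: every linear functional of it
is a centered real Gaussian with the corresponding variance. -/
def IsCenteredGaussianVec {Ω : Type*} [MeasurableSpace Ω] {n : ℕ} (P : Measure Ω)
    (W : Ω → EuclideanSpace ℝ (Fin n)) (R : Matrix (Fin n) (Fin n) ℝ) : Prop :=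
  ∀ a : Fin n → ℝ, Measure.map (fun ω => ∑ i, a i * W ω i) P
    = gaussianReal 0 (Real.toNNReal (∑ i, ∑ j, a i * R i j * a j))

/-- Hadamard (element-wise) product of two Euclidean vectors. -/
def hadamard {n : ℕ} (u v : EuclideanSpace ℝ (Fin n)) : EuclideanSpace ℝ (Fin n) :=
  (WithLp.equiv 2 (Fin n → ℝ)).symm fun i => u i * v i

end

noncomputable section
open MeasureTheory Real ProbabilityTheory

lemma int_dom {n : ℕ} {f : EuclideanSpace ℝ (Fin n) → ℝ} (hf : IsDensity f)
    (hm : Integrable fun x : EuclideanSpace ℝ (Fin n) => f x * ‖x‖ ^ 2)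
    (h : EuclideanSpace ℝ (Fin n) → ℝ) (hc : Continuous h) (C : ℝ)
    (hb : ∀ x, |h x| ≤ C * (1 + ‖x‖ ^ 2)) : Integrable fun x => f x * h x := by
  have hi : Integrable fun x => C * (f x + f x * ‖x‖ ^ 2) := (hf.2.1.add hm).const_mul C
  refine hi.mono' (hf.2.1.aestronglyMeasurable.mul hc.aestronglyMeasurable) ?_
  filter_upwards with x
  rw [norm_mul, Real.norm_eq_abs, Real.norm_eq_abs, abs_of_nonneg (hf.1 x)]
  nlinarith [mul_le_mul_of_nonneg_left (hb x) (hf.1 x)]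

lemma abs_coord_le {n : ℕ} (x : EuclideanSpace ℝ (Fin n)) (i : Fin n) : |x i| ≤ ‖x‖ := by
  simpa using PiLp.norm_apply_le x i

lemma int_cc {n : ℕ} {f : EuclideanSpace ℝ (Fin n) → ℝ} (hf : IsDensity f)
    (hm : Integrable fun x : EuclideanSpace ℝ (Fin n) => f x * ‖x‖ ^ 2)
    (a b : ℝ) (i j : Fin n) :
    Integrable fun x => f x * ((x i - a) * (x j - b)) := by
  refine int_dom hf hm _ (by fun_prop) ((1 + |a|) * (1 + |b|) * 2) ?_
  intro x
  have h1 : |x i - a| ≤ (1 + |a|) * (1 + ‖x‖) := by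
    have := abs_sub (x i) a
    have := abs_coord_le x i
    nlinarith [abs_nonneg a, norm_nonneg x, mul_nonneg (abs_nonneg a) (norm_nonneg x)]
  have h2 : |x j - b| ≤ (1 + |b|) * (1 + ‖x‖) := by
    have := abs_sub (x j) b
    have := abs_coord_le x j
    nlinarith [abs_nonneg b, norm_nonneg x, mul_nonneg (abs_nonneg b) (norm_nonneg x)]
  rw [abs_mul]
  calc |x i - a| * |x j - b| ≤ ((1 + |a|) * (1 + ‖x‖)) * ((1 + |b|) * (1 + ‖x‖)) := by
        gcongr
    _ = (1 + |a|) * (1 + |b|) * (1 + ‖x‖) ^ 2 := by ring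
    _ ≤ (1 + |a|) * (1 + |b|) * (2 * (1 + ‖x‖ ^ 2)) := by
        gcongr
        nlinarith [sq_nonneg (1 - ‖x‖)]
    _ = _ := by ring

lemma int_c {n : ℕ} {f : EuclideanSpace ℝ (Fin n) → ℝ} (hf : IsDensity f)
    (hm : Integrable fun x : EuclideanSpace ℝ (Fin n) => f x * ‖x‖ ^ 2) (i : Fin n) :
    Integrable fun x => f x * x i := by
  refine int_dom hf hm _ (by fun_prop) 1 ?_
  intro x
  have := abs_coord_le x i
  nlinarith [sq_nonneg (1 - ‖x‖), norm_nonneg x]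

lemma covMat_apply' {n : ℕ} (f : EuclideanSpace ℝ (Fin n) → ℝ) (i j : Fin n) :
    covMat f i j = ∫ x, f x * ((x i - meanVec f i) * (x j - meanVec f j)) := by
  simp [covMat, mul_assoc]

lemma covMat_symm {n : ℕ} (f : EuclideanSpace ℝ (Fin n) → ℝ) (i j : Fin n) :
    covMat f i j = covMat f j i := by
  rw [covMat_apply', covMat_apply']
  congr 1; ext x; ring

lemma int_quad {n : ℕ} {f : EuclideanSpace ℝ (Fin n) → ℝ} (hf : IsDensity f)
    (hm : Integrable fun x : EuclideanSpace ℝ (Fin n) => f x * ‖x‖ ^ 2)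
    (A : Matrix (Fin n) (Fin n) ℝ) :
    Integrable (fun x => f x * ∑ i, ∑ j, (x i - meanVec f i) * A i j * (x j - meanVec f j)) ∧
    ∫ x, f x * ∑ i, ∑ j, (x i - meanVec f i) * A i j * (x j - meanVec f j)
      = ∑ i, ∑ j, A i j * covMat f i j := by
  have e : ∀ x : EuclideanSpace ℝ (Fin n),
      f x * ∑ i, ∑ j, (x i - meanVec f i) * A i j * (x j - meanVec f j)
      = ∑ i, ∑ j, A i j * (f x * ((x i - meanVec f i) * (x j - meanVec f j))) := by
    intro x
    simp only [Finset.mul_sum]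
    refine Finset.sum_congr rfl fun i _ => Finset.sum_congr rfl fun j _ => by ring
  simp only [e]
  have hI : ∀ i j, Integrable fun x : EuclideanSpace ℝ (Fin n) =>
      A i j * (f x * ((x i - meanVec f i) * (x j - meanVec f j))) :=
    fun i j => (int_cc hf hm _ _ i j).const_mul _
  refine ⟨integrable_finsetSum _ fun i _ => integrable_finsetSum _ fun j _ => hI i j, ?_⟩
  rw [integral_finsetSum _ fun i _ => integrable_finsetSum _ fun j _ => hI i j]
  refine Finset.sum_congr rfl fun i _ => ?_
  rw [integral_finsetSum _ fun j _ => hI i j]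
  refine Finset.sum_congr rfl fun j _ => ?_
  rw [integral_const_mul, covMat_apply']

lemma covMat_psd {n : ℕ} {f : EuclideanSpace ℝ (Fin n) → ℝ} (hf : IsDensity f)
    (hm : Integrable fun x : EuclideanSpace ℝ (Fin n) => f x * ‖x‖ ^ 2) :
    (covMat f).PosSemidef := by
  refine Matrix.PosSemidef.of_dotProduct_mulVec_nonneg ?_ ?_
  · ext i j
    simp [covMat_symm f i j]
  · intro a
    have h := (int_quad hf hm (Matrix.of fun i j => a i * a j)).2
    have e : star a ⬝ᵥ (covMat f).mulVec a = ∑ i, ∑ j, a i * a j * covMat f i j := by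
      simp only [dotProduct, Matrix.mulVec, Finset.mul_sum, star_trivial]
      refine Finset.sum_congr rfl fun i _ => Finset.sum_congr rfl fun j _ => by ring
    rw [e]
    simp only [Matrix.of_apply] at h
    rw [← h]
    refine integral_nonneg fun x => mul_nonneg (hf.1 x) ?_
    have : ∑ i, ∑ j, (x i - meanVec f i) * (a i * a j) * (x j - meanVec f j)
        = (∑ i, a i * (x i - meanVec f i)) ^ 2 := by
      rw [sq, Finset.sum_mul_sum]
      refine Finset.sum_congr rfl fun i _ => Finset.sum_congr rfl fun j _ => by ring
    rw [this]; positivity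

lemma trace_le {n : ℕ} {f : EuclideanSpace ℝ (Fin n) → ℝ} (hf : IsDensity f)
    (hm : Integrable fun x : EuclideanSpace ℝ (Fin n) => f x * ‖x‖ ^ 2) :
    (covMat f).trace ≤ ∫ x, f x * ‖x‖ ^ 2 := by
  have hI : ∀ i, Integrable fun x : EuclideanSpace ℝ (Fin n) => f x * (x i * x i) := fun i => by
    simpa using int_cc hf hm 0 0 i i
  have e : ∀ x : EuclideanSpace ℝ (Fin n), f x * ‖x‖ ^ 2 = ∑ i, f x * (x i * x i) := by
    intro x
    rw [EuclideanSpace.norm_sq_eq, Finset.mul_sum]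
    refine Finset.sum_congr rfl fun i _ => by
      rw [Real.norm_eq_abs, sq_abs, sq]
  simp only [e]
  rw [integral_finsetSum _ fun i _ => hI i, Matrix.trace]
  refine Finset.sum_le_sum fun i _ => ?_
  rw [Matrix.diag_apply, covMat_apply']
  have e2 : ∀ x : EuclideanSpace ℝ (Fin n),
      f x * ((x i - meanVec f i) * (x i - meanVec f i))
      = (f x * (x i * x i) - 2 * meanVec f i * (f x * x i)) + meanVec f i ^ 2 * f x := by
    intro x; ring
  simp only [e2]
  have hA : Integrable fun x : EuclideanSpace ℝ (Fin n) =>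
      f x * (x i * x i) - 2 * meanVec f i * (f x * x i) :=
    (hI i).sub ((int_c hf hm i).const_mul _)
  rw [integral_add hA (hf.2.1.const_mul _),
    integral_sub (hI i) ((int_c hf hm i).const_mul _), integral_const_mul, integral_const_mul,
    hf.2.2]
  have : ∫ x, f x * x i = meanVec f i := rfl
  rw [this]
  nlinarith [sq_nonneg (meanVec f i)]

lemma log_det_le {n : ℕ} {R : Matrix (Fin n) (Fin n) ℝ} (hR : R.PosSemidef) (hd : R.det ≠ 0)
    (hn : 1 ≤ n) : 0 < R.det ∧ 0 < R.trace ∧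
      ∀ v : ℝ, 0 < v → Real.log R.det ≤ R.trace / v - n + n * Real.log v := by
  have hdet : R.det = ∏ i, hR.1.eigenvalues i := by
    simpa using hR.1.det_eq_prod_eigenvalues
  have htr : R.trace = ∑ i, hR.1.eigenvalues i := by
    simpa using hR.1.trace_eq_sum_eigenvalues
  have hpos : ∀ i, 0 < hR.1.eigenvalues i := by
    intro i
    refine lt_of_le_of_ne (hR.eigenvalues_nonneg i) fun h => hd ?_
    rw [hdet]
    exact Finset.prod_eq_zero (Finset.mem_univ i) h.symm
  refine ⟨hdet ▸ Finset.prod_pos fun i _ => hpos i, ?_, ?_⟩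
  · rw [htr]
    exact Finset.sum_pos (fun i _ => hpos i) ⟨⟨0, hn⟩, Finset.mem_univ _⟩
  · intro v hv
    rw [hdet, htr, Real.log_prod (fun i _ => (hpos i).ne')]
    have : ∀ i, Real.log (hR.1.eigenvalues i) ≤ hR.1.eigenvalues i / v - 1 + Real.log v := by
      intro i
      have := Real.log_le_sub_one_of_pos (div_pos (hpos i) hv)
      rw [Real.log_div (hpos i).ne' hv.ne'] at this
      linarith
    refine (Finset.sum_le_sum fun i _ => this i).trans (le_of_eq ?_)
    simp [Finset.sum_add_distrib, Finset.sum_div]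

lemma reg_log {n : ℕ} {f : EuclideanSpace ℝ (Fin n) → ℝ} {c₁ c₂ : ℝ} (hc₁ : 0 < c₁)
    (hreg : IsRegularDensity c₁ c₂ f) (x : EuclideanSpace ℝ (Fin n)) :
    |Real.log (f x) - Real.log (f 0)| ≤ c₁ * ‖x‖ ^ 2 + c₂ * ‖x‖ := by
  obtain ⟨hp, hd, hg⟩ := hreg
  have h := Convex.norm_image_sub_le_of_norm_fderiv_le (𝕜 := ℝ)
    (f := fun y => Real.log (f y)) (s := Metric.closedBall 0 ‖x‖) (C := c₁ * ‖x‖ + c₂)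
    (x := 0) (y := x)
    (fun y _ => (hd y).log (hp y).ne')
    (fun y hy => by
      have h1 := hg y
      rw [gradient, LinearIsometryEquiv.norm_map] at h1
      have : ‖y‖ ≤ ‖x‖ := by simpa using hy
      nlinarith)
    (convex_closedBall _ _) (by simp) (by simp)
  rw [Real.norm_eq_abs, sub_zero] at h
  calc _ ≤ _ := h
    _ = _ := by ring

lemma kl_le {n : ℕ} (hn : 1 ≤ n) {f : EuclideanSpace ℝ (Fin n) → ℝ} (hf : IsDensity f)
    (hm : Integrable fun x : EuclideanSpace ℝ (Fin n) => f x * ‖x‖ ^ 2)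
    {c₁ c₂ : ℝ} (hc₁ : 0 < c₁) (hc₂ : 0 ≤ c₂) (hreg : IsRegularDensity c₁ c₂ f) :
    KLtoGauss f ≤ 2 * c₁ * (∫ x, f x * ‖x‖ ^ 2) + 2 * c₂ * √(∫ x, f x * ‖x‖ ^ 2) := by
  have hS0 : 0 ≤ ∫ x, f x * ‖x‖ ^ 2 :=
    integral_nonneg fun x => mul_nonneg (hf.1 x) (by positivity)
  have htr := trace_le hf hm
  set S := ∫ x, f x * ‖x‖ ^ 2 with hS
  have hRHS : 0 ≤ 2 * c₁ * S + 2 * c₂ * √S := by positivity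
  set R := covMat f with hR
  by_cases hd : R.det = 0
  · have : KLtoGauss f = 0 := by
      have h0 : ((0 : ℝ) ^ (-(1 : ℝ) / 2)) = 0 := Real.zero_rpow (by norm_num)
      simp only [KLtoGauss, klDiv', gaussDensity, ← hR, hd, h0]
      simp
    rw [this]; exact hRHS
  have hpsd : R.PosSemidef := covMat_psd hf hm
  obtain ⟨hdpos, htpos, hlog⟩ := log_det_le hpsd hd hn
  have hSpos : 0 < S := htpos.trans_le htr
  have hnpos : (0 : ℝ) < n := by exact_mod_cast hn
  set s := √S with hs
  have hspos : 0 < s := Real.sqrt_pos.mpr hSpos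
  have hss : s ^ 2 = S := Real.sq_sqrt hS0
  set v := S / n with hv
  have hvpos : 0 < v := by positivity
  set a := 2 * c₁ + c₂ / s with ha
  have hapos : 0 < a := by positivity
  set b := c₂ * s / 2 with hb
  have hψ : ∀ x, |Real.log (f x) - Real.log (f 0)| ≤ a / 2 * ‖x‖ ^ 2 + b := by
    intro x
    refine (reg_log hc₁ hreg x).trans ?_
    have : c₂ * ‖x‖ ≤ c₂ / s / 2 * ‖x‖ ^ 2 + c₂ * s / 2 := by
      have e : c₂ / s / 2 * ‖x‖ ^ 2 + c₂ * s / 2 - c₂ * ‖x‖ = c₂ / s / 2 * (‖x‖ - s) ^ 2 := by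
        field_simp; ring
      have : 0 ≤ c₂ / s / 2 * (‖x‖ - s) ^ 2 := by positivity
      linarith
    rw [ha, hb]; linarith
  set L := Real.log (f 0) with hL
  -- bound on `L`
  have hLb : L ≤ b - n / 2 * Real.log (2 * π / a) := by
    have hG := GaussianFourier.integral_rexp_neg_mul_sq_norm
      (V := EuclideanSpace ℝ (Fin n)) (b := a / 2) (by positivity)
    have hGpos : 0 < (π / (a / 2)) ^ ((n : ℝ) / 2) := by positivity
    simp only [finrank_euclideanSpace, Fintype.card_fin] at hG
    have hGi : Integrable fun x : EuclideanSpace ℝ (Fin n) => Real.exp (-(a / 2) * ‖x‖ ^ 2) := by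
      by_contra h
      rw [integral_undef h] at hG
      exact hGpos.ne hG
    have hle : ∫ x : EuclideanSpace ℝ (Fin n), Real.exp (L - b) * Real.exp (-(a / 2) * ‖x‖ ^ 2)
        ≤ ∫ x, f x := by
      refine integral_mono (hGi.const_mul _) hf.2.1 fun x => ?_
      simp only
      rw [← Real.exp_add, ← Real.le_log_iff_exp_le (hreg.1 x)]
      have := (abs_le.mp (hψ x)).1
      linarith
    rw [integral_const_mul, hG, hf.2.2] at hle
    have := Real.log_le_log (by positivity) hle
    rw [Real.log_mul (Real.exp_pos _).ne' hGpos.ne', Real.log_exp, Real.log_one,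
      Real.log_rpow (by positivity)] at this
    have e : π / (a / 2) = 2 * π / a := by field_simp
    rw [e] at this
    linarith
  -- pointwise bound
  set Q : EuclideanSpace ℝ (Fin n) → ℝ := fun x =>
    ∑ i, ∑ j, (x i - meanVec f i) * R⁻¹ i j * (x j - meanVec f j) with hQ
  obtain ⟨hQi, hQe⟩ := int_quad hf hm R⁻¹
  have hQn : ∑ i, ∑ j, R⁻¹ i j * covMat f i j = n := by
    have h1 : R⁻¹ * R = 1 := Matrix.nonsing_inv_mul _ (Ne.isUnit hd)
    have h2 : (R⁻¹ * R).trace = n := by rw [h1]; simp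
    rw [← h2, Matrix.trace]
    refine Finset.sum_congr rfl fun i _ => ?_
    rw [Matrix.diag_apply, Matrix.mul_apply]
    refine Finset.sum_congr rfl fun j _ => ?_
    rw [hR, covMat_symm f i j]
  rw [hQn] at hQe
  set K := L + b + n / 2 * Real.log (2 * π) + 1 / 2 * Real.log R.det with hK
  have hpt : ∀ x, f x * Real.log (f x / gaussDensity (meanVec f) R x)
      ≤ (K * f x + a / 2 * (f x * ‖x‖ ^ 2)) + 1 / 2 * (f x * Q x) := by
    intro x
    have hg : Real.log (gaussDensity (meanVec f) R x)
        = -(n / 2 * Real.log (2 * π)) - 1 / 2 * Real.log R.det - 1 / 2 * Q x := by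
      rw [gaussDensity, Real.log_mul (by positivity) (by positivity),
        Real.log_mul (by positivity) (by positivity), Real.log_exp, Real.log_rpow (by positivity),
        Real.log_rpow hdpos]
      simp only [hQ]; ring
    have hgp : gaussDensity (meanVec f) R x ≠ 0 := by
      rw [gaussDensity]; positivity
    rw [Real.log_div (hreg.1 x).ne' hgp, hg]
    have h1 := (abs_le.mp (hψ x)).2
    have := mul_le_mul_of_nonneg_left h1 (hf.1 x)
    rw [hK]
    linarith
  have hint : KLtoGauss f ≤ max 0 (K + a / 2 * S + 1 / 2 * n) := by
    by_cases hi : Integrable fun x => f x * Real.log (f x / gaussDensity (meanVec f) R x)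
    · refine le_max_of_le_right ?_
      have hA : Integrable fun x => K * f x + a / 2 * (f x * ‖x‖ ^ 2) :=
        (hf.2.1.const_mul _).add (hm.const_mul _)
      have hB : Integrable fun x => 1 / 2 * (f x * Q x) := hQi.const_mul _
      refine (integral_mono hi (hA.add hB) hpt).trans (le_of_eq ?_)
      simp only [Pi.add_apply]
      rw [integral_add hA hB, integral_add (hf.2.1.const_mul _) (hm.const_mul _),
        integral_const_mul, integral_const_mul, integral_const_mul, hf.2.2, hQe, mul_one]
    · refine le_max_of_le_left (le_of_eq ?_)
      exact integral_undef hi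
  refine hint.trans (max_le hRHS ?_)
  have hlv := hlog v hvpos
  have hnv : S / v = n := by rw [hv]; field_simp
  have htv : R.trace / v ≤ n := by rw [← hnv]; gcongr
  have hav := Real.log_le_sub_one_of_pos (mul_pos hapos hvpos)
  rw [Real.log_mul hapos.ne' hvpos.ne'] at hav
  rw [Real.log_div (by positivity) hapos.ne'] at hLb
  have haS : a * S = 2 * c₁ * S + c₂ * s := by
    rw [ha, ← hss]; field_simp
  have hnav : n * (a * v) = a * S := by rw [hv]; field_simp
  have h3 := mul_le_mul_of_nonneg_left hav hnpos.le
  rw [hK]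
  nlinarith

theorem stmt1 {Ω : Type*} [MeasurableSpace Ω] (P : Measure Ω) [IsProbabilityMeasure P]
    (X : ℕ → Ω → ℝ) (hXmeas : ∀ k, Measurable (X k))
    (f : (n : ℕ) → EuclideanSpace ℝ (Fin n) → ℝ)
    (hstat : ∀ n k, Measure.map (pathVec X k n) P = Measure.map (pathVec X 0 n) P)
    (hlaw : ∀ n, Measure.map (pathVec X 0 n) P
      = volume.withDensity fun x => ENNReal.ofReal (f n x))
    (hdens : ∀ n, IsDensity (f n))
    (hmom : ∀ n, Integrable fun x : EuclideanSpace ℝ (Fin n) => f n x * ‖x‖ ^ 2)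
    (c₁ c₂ : ℝ) (hc₁ : 0 < c₁) (hc₂ : 0 ≤ c₂)
    (hreg : ∀ n, IsRegularDensity c₁ c₂ (f n)) :
    ∀ n : ℕ, 1 ≤ n → (1 / n : ℝ) * KLtoGauss (f n) ≤
      2 * c₁ * (∫ ω, (X 0 ω) ^ 2 ∂P)
        + 2 * c₂ * Real.sqrt (∫ ω, (X 0 ω) ^ 2 ∂P) / Real.sqrt n := by
  intro n hn
  have hpm : ∀ k n, Measurable (pathVec X k n) := by
    intro k n
    refine (WithLp.measurable_toLp 2 (Fin n → ℝ)).comp ?_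
    exact measurable_pi_lambda _ fun i => hXmeas _
  have hfm : ∀ n, Measurable (f n) := fun n => (hreg n).2.1.continuous.measurable
  -- expectation transfer
  have htrans : ∀ n (h : EuclideanSpace ℝ (Fin n) → ℝ), Continuous h →
      ∫ ω, h (pathVec X 0 n ω) ∂P = ∫ x, f n x * h x := by
    intro n h hc
    rw [← integral_map (hpm 0 n).aemeasurable hc.aestronglyMeasurable, hlaw n,
      integral_withDensity_eq_integral_toReal_smul (hfm n).ennreal_ofReal (by simp)]
    refine integral_congr_ae (Filter.Eventually.of_forall fun x => ?_)
    simp [ENNReal.toReal_ofReal ((hdens n).1 x)]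
  have hstat1 : ∀ k, ∫ ω, (X k ω) ^ 2 ∂P = ∫ ω, (X 0 ω) ^ 2 ∂P := by
    intro k
    have hc : Continuous fun x : EuclideanSpace ℝ (Fin 1) => x 0 ^ 2 := by fun_prop
    have e : ∀ k, ∫ ω, (X k ω) ^ 2 ∂P
        = ∫ x, (x 0) ^ 2 ∂(Measure.map (pathVec X k 1) P) := by
      intro k
      rw [integral_map (hpm k 1).aemeasurable hc.aestronglyMeasurable]
      simp [pathVec]
    rw [e k, e 0, hstat 1 k]
  have hS : ∫ x, f n x * ‖x‖ ^ 2 = n * ∫ ω, (X 0 ω) ^ 2 ∂P := by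
    have e : ∀ x : EuclideanSpace ℝ (Fin n), f n x * ‖x‖ ^ 2 = ∑ i, f n x * (x i * x i) := by
      intro x
      rw [EuclideanSpace.norm_sq_eq, Finset.mul_sum]
      refine Finset.sum_congr rfl fun i _ => by
        rw [Real.norm_eq_abs, sq_abs, sq]
    simp only [e]
    rw [integral_finsetSum _ fun i _ => by simpa using int_cc (hdens n) (hmom n) 0 0 i i]
    have : ∀ i : Fin n, ∫ x, f n x * (x i * x i) = ∫ ω, (X 0 ω) ^ 2 ∂P := by
      intro i
      rw [← htrans n (fun x => x i * x i) (by fun_prop), ← hstat1 i]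
      simp [pathVec, sq]
    simp [this]
  have hmain := kl_le hn (hdens n) (hmom n) hc₁ hc₂ (hreg n)
  rw [hS] at hmain
  have hnpos : (0 : ℝ) < n := by exact_mod_cast hn
  rw [Real.sqrt_mul hnpos.le] at hmain
  have hq : √(n : ℝ) ^ 2 = n := Real.sq_sqrt hnpos.le
  have hqp : 0 < √(n : ℝ) := Real.sqrt_pos.mpr hnpos
  set E := ∫ ω, (X 0 ω) ^ 2 ∂P
  calc (1 / n : ℝ) * KLtoGauss (f n)
      ≤ (1 / n : ℝ) * (2 * c₁ * (n * E) + 2 * c₂ * (√(n : ℝ) * √E)) := by gcongr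
    _ = 2 * c₁ * E + 2 * c₂ * √E * (√(n : ℝ) / n) := by field_simp
    _ = _ := by
      have : √(n : ℝ) / n = 1 / √(n : ℝ) := by
        rw [div_eq_div_iff hnpos.ne' hqp.ne', ← sq, hq, one_mul]
      rw [this]; ring

end
end

section
/- Let {X_k}_{k≥1} be a stationary real-valued process such that for every n the vector X^n = (X_1,…,X_n) has a probability density f^(n) on ℝ^n with finite second moments, and suppose every f^(n) is (c1,c2)-regular with constants c1 > 0, c2 ≥ 0 independent of n. Let μ = E[X_1] and σ² = Var(X_1). Then limsup_{n→∞} (1/n)·D(f^(n)) ≤ 2·c1·(μ² + σ²). -/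
open MeasureTheory Real ProbabilityTheory
open scoped BigOperators ENNReal

noncomputable section
open MeasureTheory Real ProbabilityTheory


lemma aux_log_bound {n : ℕ} {c₁ c₂ : ℝ} {f : EuclideanSpace ℝ (Fin n) → ℝ}
    (h : IsRegularDensity c₁ c₂ f) (x : EuclideanSpace ℝ (Fin n)) :
    |Real.log (f x) - Real.log (f 0)| ≤ c₁ / 2 * ‖x‖ ^ 2 + c₂ * ‖x‖ := by
  obtain ⟨hpos, hd, hg⟩ := h
  have hdl : ∀ y, DifferentiableAt ℝ (fun y => Real.log (f y)) y := fun y =>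
    (hd y).log (hpos y).ne'
  have hder : ∀ t : ℝ, HasDerivAt (fun t : ℝ => Real.log (f (t • x)) - Real.log (f 0))
      (inner ℝ (gradient (fun y => Real.log (f y)) (t • x)) x) t := by
    intro t
    have h1 := (hdl (t • x)).hasGradientAt.hasFDerivAt
    have h2 : HasDerivAt (fun t : ℝ => t • x) x t := by
      simpa using (hasDerivAt_id t).smul_const x
    have h3 := h1.comp_hasDerivAt t h2
    simpa using h3.sub_const (Real.log (f 0))
  have hB : ∀ t : ℝ, HasDerivAt (fun t : ℝ => c₁ / 2 * ‖x‖ ^ 2 * t ^ 2 + c₂ * ‖x‖ * t)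
      (c₁ * ‖x‖ ^ 2 * t + c₂ * ‖x‖) t := by
    intro t
    have := ((hasDerivAt_pow 2 t).const_mul (c₁ / 2 * ‖x‖ ^ 2)).add
      ((hasDerivAt_id t).const_mul (c₂ * ‖x‖))
    refine this.congr_deriv ?_
    push_cast
    ring
  have key := image_norm_le_of_norm_deriv_right_le_deriv_boundary (a := 0) (b := 1)
    (f := fun t : ℝ => Real.log (f (t • x)) - Real.log (f 0))
    (B := fun t : ℝ => c₁ / 2 * ‖x‖ ^ 2 * t ^ 2 + c₂ * ‖x‖ * t)
    (B' := fun t : ℝ => c₁ * ‖x‖ ^ 2 * t + c₂ * ‖x‖)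
    (f' := fun t => inner ℝ (gradient (fun y => Real.log (f y)) (t • x)) x)
    (fun t _ => (hder t).continuousAt.continuousWithinAt)
    (fun t _ => (hder t).hasDerivWithinAt) (by simp) hB ?_ (x := 1) (by simp)
  · simpa [Real.norm_eq_abs] using key
  · intro t ht
    refine (norm_inner_le_norm _ _).trans ?_
    have h1 := hg (t • x)
    rw [norm_smul, Real.norm_of_nonneg ht.1] at h1
    have := mul_le_mul_of_nonneg_right h1 (norm_nonneg x)
    nlinarith

lemma aux_log_bound2 {n : ℕ} {c₁ c₂ : ℝ} (hc₁ : 0 < c₁) {f : EuclideanSpace ℝ (Fin n) → ℝ}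
    (h : IsRegularDensity c₁ c₂ f) (x : EuclideanSpace ℝ (Fin n)) :
    |Real.log (f x) - Real.log (f 0)| ≤ c₁ * ‖x‖ ^ 2 + c₂ ^ 2 / (2 * c₁) := by
  refine (aux_log_bound h x).trans ?_
  have : c₁ * ‖x‖ ^ 2 + c₂ ^ 2 / (2 * c₁) - (c₁ / 2 * ‖x‖ ^ 2 + c₂ * ‖x‖)
      = (c₁ * ‖x‖ - c₂) ^ 2 / (2 * c₁) := by
    field_simp; ring
  have h2 : 0 ≤ (c₁ * ‖x‖ - c₂) ^ 2 / (2 * c₁) := by positivity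
  linarith

lemma aux_log_zero {n : ℕ} {c₁ c₂ : ℝ} (hc₁ : 0 < c₁) {f : EuclideanSpace ℝ (Fin n) → ℝ}
    (h : IsRegularDensity c₁ c₂ f) (hf : IsDensity f) :
    Real.log (f 0) ≤ c₂ ^ 2 / (2 * c₁) + n / 2 * Real.log (c₁ / π) := by
  have hInt := GaussianFourier.integral_rexp_neg_mul_sq_norm (V := EuclideanSpace ℝ (Fin n)) hc₁
  have hne : (0:ℝ) < (π / c₁) ^ ((n : ℝ) / 2) := by positivity
  simp only [finrank_euclideanSpace, Fintype.card_fin] at hInt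
  have hI : Integrable (fun v : EuclideanSpace ℝ (Fin n) => Real.exp (-c₁ * ‖v‖ ^ 2)) := by
    by_contra hc
    rw [integral_undef hc] at hInt
    exact hne.ne hInt
  have hle : ∫ v : EuclideanSpace ℝ (Fin n),
      (f 0 * Real.exp (-(c₂ ^ 2 / (2 * c₁)))) * Real.exp (-c₁ * ‖v‖ ^ 2) ≤ ∫ v, f v := by
    refine integral_mono (hI.const_mul _) hf.2.1 fun v => ?_
    have h1 := neg_le_of_abs_le (aux_log_bound2 hc₁ h v)
    rw [← Real.log_le_log_iff (by have := h.1 0; positivity) (h.1 v),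
      Real.log_mul (by have := h.1 0; positivity) (by positivity),
      Real.log_mul (by have := h.1 0; positivity) (by positivity), Real.log_exp, Real.log_exp]
    linarith
  rw [integral_const_mul, hInt, hf.2.2] at hle
  have h2 := Real.log_le_log (by have := h.1 0; positivity) hle
  rw [Real.log_mul (by have := h.1 0; positivity) (by positivity),
      Real.log_mul (by have := h.1 0; positivity) (by positivity), Real.log_exp,
      Real.log_rpow (by positivity), Real.log_one, ← inv_div c₁ π, Real.log_inv] at h2
  linarith

lemma aux_det {n : ℕ} (R : Matrix (Fin n) (Fin n) ℝ) (hR : R.PosSemidef) (hdet : 0 < R.det)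
    (c : ℝ) (hc : 0 < c) :
    Real.log R.det ≤ c * R.trace - n - n * Real.log c := by
  have h1 := hR.1.det_eq_prod_eigenvalues
  have h2 := hR.1.trace_eq_sum_eigenvalues
  simp only [RCLike.ofReal_real_eq_id, id] at h1 h2
  have hpos : ∀ i, 0 < hR.1.eigenvalues i := by
    intro i
    refine lt_of_le_of_ne (hR.eigenvalues_nonneg i) fun hi => hdet.ne' ?_
    rw [h1]; exact Finset.prod_eq_zero (Finset.mem_univ i) hi.symm
  rw [h1, h2, Real.log_prod (fun i _ => (hpos i).ne'), Finset.mul_sum]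
  have : ∀ i, Real.log (hR.1.eigenvalues i) ≤ c * hR.1.eigenvalues i - 1 - Real.log c := by
    intro i
    have h3 := Real.log_le_sub_one_of_pos (mul_pos hc (hpos i))
    rw [Real.log_mul hc.ne' (hpos i).ne'] at h3
    linarith
  refine (Finset.sum_le_sum fun i _ => this i).trans (le_of_eq ?_)
  simp [Finset.sum_sub_distrib]

section moments
variable {n : ℕ} {f : EuclideanSpace ℝ (Fin n) → ℝ}

lemma aux_int_xx (hf : IsDensity f) (hm : Integrable fun x => f x * ‖x‖ ^ 2) (i j : Fin n) :
    Integrable fun x => f x * (x i * x j) := by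
  refine hm.mono (hf.2.1.aestronglyMeasurable.mul (by fun_prop)) (ae_of_all _ fun x => ?_)
  have h1 : |x i| ≤ ‖x‖ := by simpa using PiLp.norm_apply_le x i
  have h2 : |x j| ≤ ‖x‖ := by simpa using PiLp.norm_apply_le x j
  simp only [norm_mul, Real.norm_eq_abs, norm_pow, abs_norm]
  have := mul_le_mul h1 h2 (abs_nonneg _) (norm_nonneg _)
  gcongr
  linarith [sq ‖x‖]

lemma aux_int_x (hf : IsDensity f) (hm : Integrable fun x => f x * ‖x‖ ^ 2) (i : Fin n) :
    Integrable fun x => f x * x i := by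
  refine (hf.2.1.add hm).mono (hf.2.1.aestronglyMeasurable.mul (by fun_prop))
    (ae_of_all _ fun x => ?_)
  have h1 : |x i| ≤ ‖x‖ := by simpa using PiLp.norm_apply_le x i
  have h0 := hf.1 x
  simp only [Pi.add_apply]
  rw [Real.norm_of_nonneg (by positivity : 0 ≤ f x + f x * ‖x‖ ^ 2), norm_mul,
    Real.norm_of_nonneg h0, Real.norm_eq_abs]
  have : |x i| ≤ 1 + ‖x‖ ^ 2 := by nlinarith [sq_nonneg (‖x‖ - 1)]
  nlinarith

lemma aux_int_cov (hf : IsDensity f) (hm : Integrable fun x => f x * ‖x‖ ^ 2) (a b : ℝ)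
    (i j : Fin n) : Integrable fun x => f x * (x i - a) * (x j - b) := by
  have := (((aux_int_xx hf hm i j).sub ((aux_int_x hf hm i).mul_const b)).sub
    ((aux_int_x hf hm j).mul_const a)).add (hf.2.1.mul_const (a * b))
  refine this.congr (ae_of_all _ fun x => ?_)
  simp only [Pi.add_apply, Pi.sub_apply]; ring

lemma aux_trace (hf : IsDensity f) (hm : Integrable fun x => f x * ‖x‖ ^ 2) :
    (covMat f).trace ≤ ∫ x, f x * ‖x‖ ^ 2 := by
  have h1 : ∫ x, f x * ‖x‖ ^ 2 = ∑ i, ∫ x, f x * (x i * x i) := by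
    rw [← integral_finsetSum _ fun i _ => aux_int_xx hf hm i i]
    congr 1; ext x
    rw [EuclideanSpace.real_norm_sq_eq, Finset.mul_sum]
    simp only [sq]
  rw [h1, Matrix.trace]
  refine Finset.sum_le_sum fun i _ => ?_
  simp only [Matrix.diag_apply, covMat, Matrix.of_apply]
  set m := meanVec f i with hmdef
  have h2 : ∫ x, f x * (x i - m) * (x i - m)
      = ∫ x, (f x * (x i * x i) - f x * x i * (2 * m) + f x * m ^ 2) := by
    congr 1; ext x; ring
  rw [h2, integral_add, integral_sub, integral_mul_const, integral_mul_const, hf.2.2]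
  · have : ∫ x, f x * x i = m := rfl
    rw [this]; nlinarith [sq_nonneg m]
  · exact aux_int_xx hf hm i i
  · exact (aux_int_x hf hm i).mul_const _
  · exact (aux_int_xx hf hm i i).sub ((aux_int_x hf hm i).mul_const _)
  · exact hf.2.1.mul_const _

lemma aux_quad_int (hf : IsDensity f) (hm : Integrable fun x => f x * ‖x‖ ^ 2)
    (A : Matrix (Fin n) (Fin n) ℝ) (i j : Fin n) :
    Integrable fun x => A i j * (f x * (x i - meanVec f i) * (x j - meanVec f j)) :=
  (aux_int_cov hf hm _ _ i j).const_mul _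

lemma aux_quad_integrable (hf : IsDensity f) (hm : Integrable fun x => f x * ‖x‖ ^ 2)
    (A : Matrix (Fin n) (Fin n) ℝ) :
    Integrable fun x => f x * ∑ i, ∑ j, (x i - meanVec f i) * A i j * (x j - meanVec f j) := by
  have := integrable_finsetSum (μ := volume) Finset.univ fun i _ =>
    integrable_finsetSum Finset.univ fun j _ => aux_quad_int hf hm A i j
  refine this.congr (ae_of_all _ fun x => ?_)
  simp only [Finset.mul_sum]
  exact Finset.sum_congr rfl fun i _ => Finset.sum_congr rfl fun j _ => by ring

lemma aux_quad (hf : IsDensity f) (hm : Integrable fun x => f x * ‖x‖ ^ 2)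
    (A : Matrix (Fin n) (Fin n) ℝ) :
    ∫ x, f x * ∑ i, ∑ j, (x i - meanVec f i) * A i j * (x j - meanVec f j)
      = ∑ i, ∑ j, A i j * covMat f i j := by
  have : ∀ x : EuclideanSpace ℝ (Fin n),
      f x * ∑ i, ∑ j, (x i - meanVec f i) * A i j * (x j - meanVec f j)
      = ∑ i, ∑ j, A i j * (f x * (x i - meanVec f i) * (x j - meanVec f j)) := by
    intro x
    simp only [Finset.mul_sum]
    exact Finset.sum_congr rfl fun i _ => Finset.sum_congr rfl fun j _ => by ring
  simp only [this]
  rw [integral_finsetSum _ fun i _ => integrable_finsetSum _ fun j _ => aux_quad_int hf hm A i j]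
  refine Finset.sum_congr rfl fun i _ => ?_
  rw [integral_finsetSum _ fun j _ => aux_quad_int hf hm A i j]
  refine Finset.sum_congr rfl fun j _ => ?_
  rw [integral_const_mul]; rfl

lemma aux_symm (i j : Fin n) : covMat f i j = covMat f j i := by
  simp only [covMat, Matrix.of_apply]
  congr 1; ext x; ring

lemma aux_psd (hf : IsDensity f) (hm : Integrable fun x => f x * ‖x‖ ^ 2) :
    (covMat f).PosSemidef := by
  refine Matrix.PosSemidef.of_dotProduct_mulVec_nonneg ?_ fun v => ?_
  · ext i j
    rw [Matrix.conjTranspose_apply, star_trivial, aux_symm]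
  · have h := aux_quad hf hm (Matrix.of fun i j => v i * v j)
    have h1 : star v ⬝ᵥ (covMat f).mulVec v = ∑ i, ∑ j, v i * v j * covMat f i j := by
      simp only [dotProduct, Matrix.mulVec, Pi.star_apply, star_trivial, Finset.mul_sum]
      exact Finset.sum_congr rfl fun i _ => Finset.sum_congr rfl fun j _ => by ring
    simp only [Matrix.of_apply] at h
    rw [h1, ← h]
    refine integral_nonneg fun x => mul_nonneg (hf.1 x) ?_
    have : ∑ i, ∑ j, (x i - meanVec f i) * (v i * v j) * (x j - meanVec f j)
        = (∑ i, v i * (x i - meanVec f i)) ^ 2 := by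
      rw [sq, Finset.sum_mul_sum]
      exact Finset.sum_congr rfl fun i _ => Finset.sum_congr rfl fun j _ => by ring
    rw [this]
    exact sq_nonneg _

lemma aux_KL {c₁ c₂ : ℝ} (hc₁ : 0 < c₁) (hreg : IsRegularDensity c₁ c₂ f)
    (hf : IsDensity f) (hm : Integrable fun x => f x * ‖x‖ ^ 2) :
    KLtoGauss f ≤ 2 * c₁ * (∫ x, f x * ‖x‖ ^ 2) + c₂ ^ 2 / c₁ := by
  have hM : 0 ≤ ∫ x, f x * ‖x‖ ^ 2 := integral_nonneg fun x => mul_nonneg (hf.1 x) (sq_nonneg _)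
  have hrhs : 0 ≤ 2 * c₁ * (∫ x, f x * ‖x‖ ^ 2) + c₂ ^ 2 / c₁ := by positivity
  have hpsd := aux_psd hf hm
  have htr := aux_trace hf hm
  unfold KLtoGauss klDiv'
  set R := covMat f with hRdef
  rcases hpsd.det_nonneg.eq_or_lt with h0 | hdet
  · have : ∀ x, gaussDensity (meanVec f) R x = 0 := by
      intro x
      unfold gaussDensity
      rw [← h0, Real.zero_rpow (by norm_num)]; ring
    simpa [this] using hrhs
  by_cases hInt : Integrable fun x => f x * Real.log (f x / gaussDensity (meanVec f) R x)
  swap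
  · rw [integral_undef hInt]; exact hrhs
  have hlogdet := aux_det R hpsd hdet (2 * c₁) (by positivity)
  have hlog0 := aux_log_zero hc₁ hreg hf
  set K : ℝ := Real.log (f 0) + c₂ ^ 2 / (2 * c₁) + n / 2 * Real.log (2 * π)
    + 1 / 2 * Real.log R.det with hK
  have hle : ∫ x, f x * Real.log (f x / gaussDensity (meanVec f) R x)
      ≤ ∫ x, (f x * K + c₁ * (f x * ‖x‖ ^ 2) + 1 / 2 *
        (f x * ∑ i, ∑ j, (x i - meanVec f i) * R⁻¹ i j * (x j - meanVec f j))) := by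
    refine integral_mono hInt (((hf.2.1.mul_const _).add (hm.const_mul _)).add
      ((aux_quad_integrable hf hm _).const_mul _)) fun x => ?_
    have hb := le_of_abs_le (aux_log_bound2 hc₁ hreg x)
    have hg : Real.log (gaussDensity (meanVec f) R x) = -(n / 2 * Real.log (2 * π))
        - 1 / 2 * Real.log R.det - 1 / 2 *
          ∑ i, ∑ j, (x i - meanVec f i) * R⁻¹ i j * (x j - meanVec f j) := by
      unfold gaussDensity
      rw [Real.log_mul (by positivity) (by positivity), Real.log_mul (by positivity)
        (by positivity), Real.log_exp, Real.log_rpow (by positivity), Real.log_rpow hdet]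
      ring
    have hgpos : gaussDensity (meanVec f) R x ≠ 0 := by
      unfold gaussDensity; positivity
    simp only
    rw [Real.log_div (hreg.1 x).ne' hgpos, hg]
    have hx := hf.1 x
    calc _ ≤ f x * (K + c₁ * ‖x‖ ^ 2 + 1 / 2 *
          ∑ i, ∑ j, (x i - meanVec f i) * R⁻¹ i j * (x j - meanVec f j)) := by
          apply mul_le_mul_of_nonneg_left _ hx
          rw [hK]; linarith
      _ = _ := by ring
  have hq : ∑ i, ∑ j, R⁻¹ i j * R i j = n := by
    have h1 : (R⁻¹ * R).trace = n := by
      rw [Matrix.nonsing_inv_mul _ (isUnit_iff_ne_zero.mpr hdet.ne')]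
      simp
    rw [← h1, Matrix.trace]
    refine Finset.sum_congr rfl fun i _ => ?_
    rw [Matrix.diag_apply, Matrix.mul_apply]
    exact Finset.sum_congr rfl fun j _ => congrArg (R⁻¹ i j * ·) (aux_symm i j)
  have hQ := (aux_quad hf hm R⁻¹).trans hq
  have hQi := aux_quad_integrable hf hm R⁻¹
  obtain ⟨G, hG⟩ : ∃ G : EuclideanSpace ℝ (Fin n) → ℝ, G = fun x =>
    f x * ∑ i, ∑ j, (x i - meanVec f i) * R⁻¹ i j * (x j - meanVec f j) := ⟨_, rfl⟩
  rw [← hG] at hQ hQi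
  replace hle : ∫ x, f x * Real.log (f x / gaussDensity (meanVec f) R x)
      ≤ ∫ x, (f x * K + c₁ * (f x * ‖x‖ ^ 2) + 1 / 2 * G x) := by
    rw [hG]; exact hle
  have hsum : ∫ x, (f x * K + c₁ * (f x * ‖x‖ ^ 2) + 1 / 2 * G x)
      = K + c₁ * (∫ x, f x * ‖x‖ ^ 2) + 1 / 2 * n := by
    rw [integral_add, integral_add, integral_mul_const, integral_const_mul, integral_const_mul,
      hQ, hf.2.2, one_mul]
    · exact hf.2.1.mul_const _
    · exact hm.const_mul _
    · exact (hf.2.1.mul_const _).add (hm.const_mul _)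
    · exact hQi.const_mul _
  refine (hle.trans hsum.le).trans ?_
  have e1 : Real.log (c₁ / π) = Real.log c₁ - Real.log π :=
    Real.log_div hc₁.ne' Real.pi_pos.ne'
  have e2 : Real.log (2 * π) = Real.log 2 + Real.log π :=
    Real.log_mul two_ne_zero Real.pi_pos.ne'
  have e3 : Real.log (2 * c₁) = Real.log 2 + Real.log c₁ := Real.log_mul two_ne_zero hc₁.ne'
  have e4 : c₂ ^ 2 / (2 * c₁) = (c₂ ^ 2 / c₁) / 2 := by field_simp
  have e5 := mul_le_mul_of_nonneg_left htr hc₁.le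
  rw [hK, e2, e4]
  rw [e3] at hlogdet
  rw [e1, e4] at hlog0
  nlinarith

end moments

lemma aux_transfer {Ω : Type*} [MeasurableSpace Ω] (P : Measure Ω) {n : ℕ}
    (Y : Ω → EuclideanSpace ℝ (Fin n)) (hY : Measurable Y) (f : EuclideanSpace ℝ (Fin n) → ℝ)
    (hf : IsDensity f) (hfd : Differentiable ℝ f)
    (hlaw : Measure.map Y P = volume.withDensity fun x => ENNReal.ofReal (f x))
    (φ : EuclideanSpace ℝ (Fin n) → ℝ) (hφ : Continuous φ) :
    ∫ ω, φ (Y ω) ∂P = ∫ x, f x * φ x ∧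
      (Integrable (fun x => f x * φ x) → Integrable (fun ω => φ (Y ω)) P) := by
  have hmf : Measurable fun x => ENNReal.ofReal (f x) :=
    hfd.continuous.measurable.ennreal_ofReal
  constructor
  · rw [← integral_map hY.aemeasurable hφ.aestronglyMeasurable, hlaw,
      integral_withDensity_eq_integral_toReal_smul hmf (ae_of_all _ fun x => ENNReal.ofReal_lt_top)]
    congr 1; ext x
    rw [ENNReal.toReal_ofReal (hf.1 x), smul_eq_mul]
  · intro h
    have : Integrable φ (Measure.map Y P) := by
      rw [hlaw, integrable_withDensity_iff hmf (ae_of_all _ fun x => ENNReal.ofReal_lt_top)]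
      refine h.congr (ae_of_all _ fun x => ?_)
      simp only
      rw [ENNReal.toReal_ofReal (hf.1 x), mul_comm]
    exact (integrable_map_measure hφ.aestronglyMeasurable hY.aemeasurable).1 this

theorem stmt2 {Ω : Type*} [MeasurableSpace Ω] (P : Measure Ω) [IsProbabilityMeasure P]
    (X : ℕ → Ω → ℝ) (hXmeas : ∀ k, Measurable (X k))
    (f : (n : ℕ) → EuclideanSpace ℝ (Fin n) → ℝ)
    (hstat : ∀ n k, Measure.map (pathVec X k n) P = Measure.map (pathVec X 0 n) P)
    (hlaw : ∀ n, Measure.map (pathVec X 0 n) P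
      = volume.withDensity fun x => ENNReal.ofReal (f n x))
    (hdens : ∀ n, IsDensity (f n))
    (hmom : ∀ n, Integrable fun x : EuclideanSpace ℝ (Fin n) => f n x * ‖x‖ ^ 2)
    (c₁ c₂ : ℝ) (hc₁ : 0 < c₁) (hc₂ : 0 ≤ c₂)
    (hreg : ∀ n, IsRegularDensity c₁ c₂ (f n))
    (μ σ2 : ℝ) (hμ : μ = ∫ ω, X 0 ω ∂P) (hσ2 : σ2 = ∫ ω, (X 0 ω - μ) ^ 2 ∂P) :
    Filter.limsup (fun n : ℕ => (1 / n : ℝ) * KLtoGauss (f n)) Filter.atTop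
      ≤ 2 * c₁ * (μ ^ 2 + σ2) := by
  have hYm : ∀ k n, Measurable (pathVec X k n) := by
    intro k n
    unfold pathVec
    exact (WithLp.measurable_toLp 2 (Fin n → ℝ)).comp
      (measurable_pi_lambda _ fun i => hXmeas _)
  -- second moments along the process
  have hsq : ∀ k, Integrable (fun ω => X k ω ^ 2) P ∧
      ∫ ω, X k ω ^ 2 ∂P = ∫ x : EuclideanSpace ℝ (Fin 1), f 1 x * (x 0 * x 0) := by
    intro k
    have ht := aux_transfer P (pathVec X k 1) (hYm k 1) (f 1) (hdens 1) (hreg 1).2.1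
      ((hstat 1 k).trans (hlaw 1)) (fun x => x 0 * x 0) (by fun_prop)
    have he : ∀ ω, (pathVec X k 1 ω) 0 * (pathVec X k 1 ω) 0 = X k ω ^ 2 := by
      intro ω; simp [pathVec, sq]
    simp only [he] at ht
    exact ⟨ht.2 (aux_int_xx (hdens 1) (hmom 1) 0 0), ht.1⟩
  have hint0 : Integrable (X 0) P := by
    have ht := aux_transfer P (pathVec X 0 1) (hYm 0 1) (f 1) (hdens 1) (hreg 1).2.1
      (hlaw 1) (fun x => x 0) (by fun_prop)
    have he : ∀ ω, (pathVec X 0 1 ω) 0 = X 0 ω := by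
      intro ω; simp [pathVec]
    simp only [he] at ht
    exact ht.2 (aux_int_x (hdens 1) (hmom 1) 0)
  have hs : ∫ ω, X 0 ω ^ 2 ∂P = μ ^ 2 + σ2 := by
    have h2 : σ2 = ∫ ω, (X 0 ω ^ 2 - X 0 ω * (2 * μ) + μ ^ 2) ∂P := by
      rw [hσ2]; congr 1; ext ω; ring
    have h3 : ∫ ω, (X 0 ω ^ 2 - X 0 ω * (2 * μ) + μ ^ 2) ∂P
        = ∫ ω, X 0 ω ^ 2 ∂P - μ * (2 * μ) + μ ^ 2 := by
      rw [integral_add, integral_sub (hsq 0).1 (hint0.mul_const _), integral_mul_const, ← hμ]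
      · simp
      · exact (hsq 0).1.sub (hint0.mul_const _)
      · exact integrable_const _
    rw [h2, h3]; ring
  have hM : ∀ n, ∫ x, f n x * ‖x‖ ^ 2 = n * (μ ^ 2 + σ2) := by
    intro n
    have ht := aux_transfer P (pathVec X 0 n) (hYm 0 n) (f n) (hdens n) (hreg n).2.1
      (hlaw n) (fun x => ‖x‖ ^ 2) (by fun_prop)
    have he : ∀ ω, ‖pathVec X 0 n ω‖ ^ 2 = ∑ i : Fin n, X i ω ^ 2 := by
      intro ω; rw [EuclideanSpace.real_norm_sq_eq]; simp [pathVec]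
    rw [← ht.1]
    simp only [he]
    rw [integral_finsetSum _ fun i _ => (hsq _).1]
    have : ∀ i : Fin n, ∫ ω, X i ω ^ 2 ∂P = μ ^ 2 + σ2 := fun i => by
      rw [(hsq i).2, ← (hsq 0).2, hs]
    simp only [this, Finset.sum_const, Finset.card_univ, Fintype.card_fin, nsmul_eq_mul]
  have hs0 : 0 ≤ μ ^ 2 + σ2 := by
    rw [← hs]; exact integral_nonneg fun ω => sq_nonneg _
  have hbound : ∀ n : ℕ, 0 < n → (1 / n : ℝ) * KLtoGauss (f n)
      ≤ 2 * c₁ * (μ ^ 2 + σ2) + (c₂ ^ 2 / c₁) / n := by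
    intro n hn
    have hn' : (0 : ℝ) < n := by exact_mod_cast hn
    have h := aux_KL hc₁ (hreg n) (hdens n) (hmom n)
    rw [hM n] at h
    calc _ ≤ (1 / n : ℝ) * (2 * c₁ * (n * (μ ^ 2 + σ2)) + c₂ ^ 2 / c₁) :=
          mul_le_mul_of_nonneg_left h (by positivity)
      _ = _ := by field_simp
  rw [Filter.limsup_eq]
  by_cases hb : BddBelow {a : ℝ | ∀ᶠ n : ℕ in Filter.atTop, (1 / n : ℝ) * KLtoGauss (f n) ≤ a}
  · refine le_of_forall_pos_le_add fun ε hε => csInf_le hb ?_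
    have ht : Filter.Tendsto (fun n : ℕ => (c₂ ^ 2 / c₁) / (n : ℝ)) Filter.atTop (nhds 0) :=
      tendsto_const_div_atTop_nhds_zero_nat _
    filter_upwards [ht.eventually (gt_mem_nhds hε), Filter.eventually_gt_atTop 0] with n h1 h2
    have := hbound n h2
    linarith
  · rw [Real.sInf_of_not_bddBelow hb]
    positivity

end
end
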